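/- (Deterministic core of Theorem 3(2) of the paper.) Let η > 0, T > 0. Let u, p be smooth, spatially ℤⁿ-periodic with div u_t = 0, solving the incompressible Navier–Stokes equation ∂_t u = −∇_u u − ∇p + ηΔu on [0,T] × ℝⁿ. Let v, q be smooth, spatially ℤⁿ-periodic with div v_t = 0, solving the linearized equation ∂_t v = −∇_u v − u'⊗v − ∇q + ηΔv on [0,T] × ℝⁿ, with the same initial datum v(0,·) = u(0,·). Then v(t,·) = u(t,·) for all t ∈ [0,T]. -/

import Mathlib

noncomputable section
open MeasureTheory

/-- Euclidean dot product on `Fin n → ℝ`. -/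
def dotp {n : ℕ} (v w : Fin n → ℝ) : ℝ := ∑ i, v i * w i

/-- Advective derivative `(∇_X ξ)(x) = Dξ(x)·X(x)`. -/
def advDeriv {n : ℕ} (X ξ : (Fin n → ℝ) → (Fin n → ℝ)) (x : Fin n → ℝ) : Fin n → ℝ :=
  fderiv ℝ ξ x (X x)

/-- Line stretching term `(X'⊗ξ)(x) = (DX(x))ᵀ·ξ(x)`. -/
def lineStretch {n : ℕ} (X ξ : (Fin n → ℝ) → (Fin n → ℝ)) (x : Fin n → ℝ) : Fin n → ℝ :=
  fun i => ∑ j, fderiv ℝ X x (Pi.single i 1) j * ξ x j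

/-- Divergence of a vector field. -/
def diver {n : ℕ} (ξ : (Fin n → ℝ) → (Fin n → ℝ)) (x : Fin n → ℝ) : ℝ :=
  ∑ i, fderiv ℝ ξ x (Pi.single i 1) i

/-- Gradient of a scalar function. -/
def gradf {n : ℕ} (f : (Fin n → ℝ) → ℝ) (x : Fin n → ℝ) : Fin n → ℝ :=
  fun i => fderiv ℝ f x (Pi.single i 1)

/-- Componentwise Laplacian. -/
def lap {n : ℕ} (ξ : (Fin n → ℝ) → (Fin n → ℝ)) (x : Fin n → ℝ) : Fin n → ℝ :=
  ∑ j, fderiv ℝ (fun y => fderiv ℝ ξ y (Pi.single j 1)) x (Pi.single j 1)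

/-- The unit cube `[0,1]ⁿ`, realizing the torus `ℝⁿ/ℤⁿ`. -/
def cube (n : ℕ) : Set (Fin n → ℝ) := Set.univ.pi fun _ => Set.Icc (0:ℝ) 1

/-- `ℤⁿ`-periodicity. -/
def ZPeriodic {n : ℕ} {α : Type*} (f : (Fin n → ℝ) → α) : Prop :=
  ∀ (x : Fin n → ℝ) (m : Fin n → ℤ), f (x + fun i => (m i : ℝ)) = f x

lemma cube_eq_Icc (n : ℕ) : cube n = Set.Icc 0 1 := Set.pi_univ_Icc (0 : Fin n → ℝ) 1

lemma isCompact_cube (n : ℕ) : IsCompact (cube n) :=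
  isCompact_univ_pi fun _ => isCompact_Icc

lemma ZPeriodic.fderiv {n : ℕ} {F : Type*} [NormedAddCommGroup F] [NormedSpace ℝ F]
    {f : (Fin n → ℝ) → F} (hf : ZPeriodic f) : ZPeriodic (fderiv ℝ f) := by
  intro x m
  rw [← fderiv_comp_add_right (fun i => (m i : ℝ))]
  congr 1
  exact funext fun y => hf y m

lemma integral_cube_diver_eq_zero {n : ℕ} {F : (Fin n → ℝ) → (Fin n → ℝ)}
    (hF : ContDiff ℝ 1 F) (hper : ZPeriodic F) : ∫ x in cube n, diver F x = 0 := by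
  cases n with
  | zero => simp [diver]
  | succ n =>
    have hcont : Continuous (diver F) := by
      have := hF.continuous_fderiv one_ne_zero
      unfold diver
      fun_prop
    have key := integral_divergence_of_hasFDerivAt_off_countable (0 : Fin (n + 1) → ℝ) 1
      zero_le_one F (fderiv ℝ F) ∅ Set.countable_empty hF.continuous.continuousOn
      (fun x _ => (hF.differentiable one_ne_zero x).hasFDerivAt)
      (hcont.continuousOn.integrableOn_compact isCompact_Icc)
    rw [cube_eq_Icc]
    refine key.trans (Finset.sum_eq_zero fun i _ => sub_eq_zero.2 ?_)
    congr 1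
    funext y
    rw [← hper (i.insertNth ((0 : Fin (n + 1) → ℝ) i) y) (Pi.single i 1)]
    congr 2
    funext j
    refine Fin.succAboveCases i ?_ (fun k => ?_) j <;> simp

lemma fderiv_apply_eq_sum {n : ℕ} (ξ : (Fin n → ℝ) → (Fin n → ℝ)) (x y : Fin n → ℝ)
    (j : Fin n) :
    fderiv ℝ ξ x y j = ∑ i, y i * fderiv ℝ ξ x (Pi.single i 1) j := by
  conv_lhs => rw [pi_eq_sum_univ' y]
  simp [Finset.sum_apply, map_sum]

lemma integral_cube_dotp_transport_diffusion_nonpos {n : ℕ} {η : ℝ} (hη : 0 ≤ η)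
    {u w : (Fin n → ℝ) → (Fin n → ℝ)} {π : (Fin n → ℝ) → ℝ}
    (hu : ContDiff ℝ 1 u) (hw : ContDiff ℝ 2 w) (hπ : ContDiff ℝ 1 π)
    (hup : ZPeriodic u) (hwp : ZPeriodic w) (hπp : ZPeriodic π)
    (hdu : ∀ x, diver u x = 0) (hdw : ∀ x, diver w x = 0) :
    IntegrableOn (fun x => dotp (w x) (-advDeriv u w x - gradf π x + η • lap w x)) (cube n) ∧
    ∫ x in cube n, dotp (w x) (-advDeriv u w x - gradf π x + η • lap w x) ≤ 0 := by
  have hw1 : ∀ v, ContDiff ℝ 1 fun y => fderiv ℝ w y v := fun v =>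
    (hw.fderiv_right (m := 1) (by norm_num)).clm_apply contDiff_const
  set F : (Fin n → ℝ) → (Fin n → ℝ) := fun x i =>
    -(1 / 2 * ∑ j, w x j * w x j) * u x i - π x * w x i
      + η * ∑ j, w x j * fderiv ℝ w x (Pi.single i 1) j with hF_def
  have hFi : ∀ i, ContDiff ℝ 1 fun x => F x i := by
    intro i
    have h1 : ContDiff ℝ 1 w := hw.of_le (by norm_num)
    have h2 := hw1 (Pi.single i 1)
    have h3 := contDiff_pi.1 h1
    have h4 := contDiff_pi.1 hu
    have h5 := contDiff_pi.1 h2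
    simp only [hF_def]
    fun_prop
  have hF : ContDiff ℝ 1 F := contDiff_pi.2 hFi
  have hFp : ZPeriodic F := by
    intro x m
    simp only [hF_def, hup x m, hwp x m, hπp x m, hwp.fderiv x m]
  have hcontF : Continuous (diver F) := by
    have := hF.continuous_fderiv one_ne_zero
    unfold diver
    fun_prop
  have hcont : Continuous fun x =>
      dotp (w x) (-advDeriv u w x - gradf π x + η • lap w x) := by
    have h1 := hw.continuous
    have h2 := hu.continuous
    have h3 := hw.continuous_fderiv two_ne_zero
    have h4 := hπ.continuous_fderiv one_ne_zero
    have h5 := fun v => (hw1 v).continuous_fderiv one_ne_zero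
    unfold dotp advDeriv gradf lap
    simp only [Pi.add_apply, Pi.sub_apply, Pi.neg_apply, Pi.smul_apply, Finset.sum_apply]
    fun_prop
  have hI := hcont.continuousOn.integrableOn_compact (μ := volume) (isCompact_cube n)
  refine ⟨hI, ?_⟩
  rw [← integral_cube_diver_eq_zero hF hFp]
  refine setIntegral_mono hI (hcontF.continuousOn.integrableOn_compact (isCompact_cube n))
    fun x => ?_
  have hcomp : ∀ i, fderiv ℝ F x (Pi.single i 1) i
      = -(∑ j, w x j * fderiv ℝ w x (Pi.single i 1) j) * u x i
        - (1 / 2 * ∑ j, w x j * w x j) * fderiv ℝ u x (Pi.single i 1) i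
        - gradf π x i * w x i - π x * fderiv ℝ w x (Pi.single i 1) i
        + η * ∑ j, (fderiv ℝ w x (Pi.single i 1) j ^ 2
          + w x j * fderiv ℝ (fun y => fderiv ℝ w y (Pi.single i 1)) x (Pi.single i 1) j) := by
    intro i
    have dw := fun j => hasFDerivAt_pi'.1 ((hw.differentiable two_ne_zero x).hasFDerivAt) j
    have du := hasFDerivAt_pi'.1 ((hu.differentiable one_ne_zero x).hasFDerivAt) i
    have dπ := (hπ.differentiable one_ne_zero x).hasFDerivAt
    have ddw := fun j => hasFDerivAt_pi'.1
      (((hw1 (Pi.single i 1)).differentiable one_ne_zero x).hasFDerivAt) j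
    have dF := hasFDerivAt_pi'.1 ((hF.differentiable one_ne_zero x).hasFDerivAt) i
    have dF' := ((((HasFDerivAt.fun_sum (u := Finset.univ)
      fun j _ => (dw j).mul (dw j)).const_mul (1 / 2)).neg.mul du).sub (dπ.mul (dw i))).add
        ((HasFDerivAt.fun_sum (u := Finset.univ) fun j _ => (dw j).mul (ddw j)).const_mul η)
    have := DFunLike.congr_fun (dF.unique dF') (Pi.single i 1)
    simp at this
    rw [this]
    simp only [gradf, Finset.sum_add_distrib, ← two_mul, ← pow_two, ← Finset.mul_sum]
    ring
  have hdiff : diver F x - dotp (w x) (-advDeriv u w x - gradf π x + η • lap w x)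
      = η * ∑ i, ∑ j, fderiv ℝ w x (Pi.single i 1) j ^ 2 := by
    have e1 : ∑ i, (∑ j, w x j * fderiv ℝ w x (Pi.single i 1) j) * u x i
        = ∑ j, w x j * ∑ i, u x i * fderiv ℝ w x (Pi.single i 1) j := by
      simp only [Finset.sum_mul, Finset.mul_sum]
      rw [Finset.sum_comm]
      exact Finset.sum_congr rfl fun j _ => Finset.sum_congr rfl fun i _ => by ring
    have e2 : ∑ i, ∑ j,
          w x j * fderiv ℝ (fun y => fderiv ℝ w y (Pi.single i 1)) x (Pi.single i 1) j
        = ∑ j, w x j * ∑ i,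
          fderiv ℝ (fun y => fderiv ℝ w y (Pi.single i 1)) x (Pi.single i 1) j := by
      simp only [Finset.mul_sum]
      exact Finset.sum_comm
    have e3 : ∑ i, gradf π x i * w x i = ∑ j, w x j * gradf π x j := by
      simp only [mul_comm]
    have hN : dotp (w x) (-advDeriv u w x - gradf π x + η • lap w x)
        = -(∑ j, w x j * ∑ i, u x i * fderiv ℝ w x (Pi.single i 1) j)
          - (∑ j, w x j * gradf π x j)
          + η * ∑ j, w x j * ∑ i,
            fderiv ℝ (fun y => fderiv ℝ w y (Pi.single i 1)) x (Pi.single i 1) j := by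
      rw [Finset.mul_sum, ← Finset.sum_neg_distrib, ← Finset.sum_sub_distrib,
        ← Finset.sum_add_distrib]
      refine Finset.sum_congr rfl fun j _ => ?_
      simp only [Pi.add_apply, Pi.sub_apply, Pi.neg_apply, Pi.smul_apply, smul_eq_mul, lap,
        advDeriv, Finset.sum_apply, fderiv_apply_eq_sum w x (u x) j]
      ring
    have hD : diver F x = -(∑ i, (∑ j, w x j * fderiv ℝ w x (Pi.single i 1) j) * u x i)
        - (1 / 2 * ∑ j, w x j * w x j) * diver u x - (∑ i, gradf π x i * w x i)
        - π x * diver w x + η * (∑ i, ∑ j, fderiv ℝ w x (Pi.single i 1) j ^ 2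
          + ∑ i, ∑ j,
            w x j * fderiv ℝ (fun y => fderiv ℝ w y (Pi.single i 1)) x (Pi.single i 1) j) := by
      unfold diver
      simp only [hcomp, Finset.sum_add_distrib, Finset.sum_sub_distrib, Finset.mul_sum,
        neg_mul, Finset.sum_neg_distrib, mul_add]
    rw [hD, hN, hdu, hdw, e1, e2, e3]
    ring
  have : 0 ≤ η * ∑ i, ∑ j, fderiv ℝ w x (Pi.single i 1) j ^ 2 := by positivity
  linarith

lemma continuousOn_setIntegral_of_continuousOn {E : Type*} [NormedAddCommGroup E]
    [MeasureSpace E] [BorelSpace E] [SecondCountableTopology E]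
    [IsFiniteMeasureOnCompacts (volume : Measure E)]
    {K : Set E} (hK : IsCompact K) {G : ℝ → E → ℝ} {a b : ℝ}
    (hG : ContinuousOn (fun z : ℝ × E => G z.1 z.2) (Set.Icc a b ×ˢ Set.univ)) :
    ContinuousOn (fun t => ∫ x in K, G t x) (Set.Icc a b) := by
  obtain ⟨C, hC⟩ := (isCompact_Icc.prod hK).exists_bound_of_continuousOn
    (hG.mono (Set.prod_mono_right (Set.subset_univ K)))
  have hx : ∀ t ∈ Set.Icc a b, Continuous (G t) := fun t ht => by
    rw [← continuousOn_univ]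
    exact hG.comp (f := fun x => (t, x)) (by fun_prop) fun x _ => ⟨ht, trivial⟩
  refine continuousOn_of_dominated (bound := fun _ => C)
    (fun t ht => (hx t ht).aestronglyMeasurable) (fun t ht => ?_)
    (integrableOn_const hK.measure_lt_top.ne) ?_
  · exact (ae_restrict_iff' hK.measurableSet).2 (.of_forall fun x hxK => hC (t, x) ⟨ht, hxK⟩)
  · exact .of_forall fun x =>
      hG.comp (f := fun t => (t, x)) (by fun_prop) fun t (ht : t ∈ Set.Icc a b) => ⟨ht, trivial⟩

lemma hasDerivAt_setIntegral_of_contDiffOn {E : Type*} [NormedAddCommGroup E] [NormedSpace ℝ E]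
    [MeasureSpace E] [BorelSpace E] [SecondCountableTopology E]
    [IsFiniteMeasureOnCompacts (volume : Measure E)]
    {K : Set E} (hK : IsCompact K) {G : ℝ → E → ℝ} {a b t : ℝ}
    (hG : ContDiffOn ℝ 1 (fun z : ℝ × E => G z.1 z.2) (Set.Icc a b ×ˢ Set.univ))
    (ht : t ∈ Set.Ioo a b) :
    IntegrableOn (fun x => derivWithin (fun τ => G τ x) (Set.Icc a b) t) K ∧
    HasDerivAt (fun t => ∫ x in K, G t x)
      (∫ x in K, derivWithin (fun τ => G τ x) (Set.Icc a b) t) t := by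
  have hab : a < b := ht.1.trans ht.2
  set S : Set (ℝ × E) := Set.Icc a b ×ˢ Set.univ with hS
  have hud : UniqueDiffOn ℝ S := (uniqueDiffOn_Icc hab).prod uniqueDiffOn_univ
  have hcd := hG.continuousOn_fderivWithin hud le_rfl
  have hderiv : ∀ s ∈ Set.Icc a b, ∀ x, HasDerivWithinAt (fun τ => G τ x)
      (fderivWithin ℝ (fun z : ℝ × E => G z.1 z.2) S (s, x) (1, 0)) (Set.Icc a b) s := by
    intro s hs x
    have h1 := (hG.differentiableOn one_ne_zero (s, x) ⟨hs, trivial⟩).hasFDerivWithinAt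
    have h2 : HasDerivWithinAt (fun τ : ℝ => (τ, x)) ((1 : ℝ), (0 : E)) (Set.Icc a b) s :=
      ((hasDerivAt_id s).prodMk (hasDerivAt_const s x)).hasDerivWithinAt
    have h3 : Set.MapsTo (fun τ : ℝ => (τ, x)) (Set.Icc a b) S := fun τ hτ => ⟨hτ, trivial⟩
    exact h1.comp_hasDerivWithinAt s h2 h3
  have heq : ∀ s ∈ Set.Icc a b, ∀ x, derivWithin (fun τ => G τ x) (Set.Icc a b) s
      = fderivWithin ℝ (fun z : ℝ × E => G z.1 z.2) S (s, x) (1, 0) := fun s hs x =>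
    (hderiv s hs x).derivWithin (uniqueDiffOn_Icc hab s hs)
  have hcont : ContinuousOn
      (fun z : ℝ × E => derivWithin (fun τ => G τ z.2) (Set.Icc a b) z.1) S :=
    (hcd.clm_apply continuousOn_const).congr fun z hz => heq z.1 hz.1 z.2
  obtain ⟨C, hC⟩ := (isCompact_Icc.prod hK).exists_bound_of_continuousOn
    (hcont.mono (Set.prod_mono_right (Set.subset_univ K)))
  have hslice : ∀ {H : ℝ × E → ℝ}, ContinuousOn H S → ∀ s ∈ Set.Icc a b,
      Continuous fun x => H (s, x) := fun hH s hs => by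
    rw [← continuousOn_univ]
    exact hH.comp (f := fun x => (s, x)) (by fun_prop) fun x _ => ⟨hs, trivial⟩
  refine hasDerivAt_integral_of_dominated_loc_of_deriv_le (bound := fun _ => C)
    (F' := fun s x => derivWithin (fun τ => G τ x) (Set.Icc a b) s) (Ioo_mem_nhds ht.1 ht.2)
    ?_ ?_ ?_ ?_ (integrableOn_const hK.measure_lt_top.ne) ?_
  · filter_upwards [Icc_mem_nhds ht.1 ht.2] with s hs
    exact (hslice hG.continuousOn s hs).aestronglyMeasurable
  · exact (hslice hG.continuousOn t
      (Set.Ioo_subset_Icc_self ht)).continuousOn.integrableOn_compact hK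
  · exact (hslice hcont t (Set.Ioo_subset_Icc_self ht)).aestronglyMeasurable
  · exact (ae_restrict_iff' hK.measurableSet).2 (.of_forall fun x hxK s hs =>
      hC (s, x) ⟨Set.Ioo_subset_Icc_self hs, hxK⟩)
  · refine .of_forall fun x s hs => ?_
    have hs' := Set.Ioo_subset_Icc_self hs
    rw [heq s hs' x]
    exact (hderiv s hs' x).hasDerivAt (Icc_mem_nhds hs.1 hs.2)

lemma eq_zero_of_deriv_le_mul {f : ℝ → ℝ} {C T : ℝ} (hf : ContinuousOn f (Set.Icc 0 T))
    (hd : ∀ t ∈ Set.Ioo 0 T, ∃ f', HasDerivAt f f' t ∧ f' ≤ C * f t)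
    (h0 : f 0 = 0) (hnn : ∀ t ∈ Set.Icc 0 T, 0 ≤ f t) : ∀ t ∈ Set.Icc 0 T, f t = 0 := by
  have hg : ∀ t ∈ Set.Ioo 0 T, ∃ g' ≤ 0,
      HasDerivAt (fun t => Real.exp (-C * t) * f t) g' t := by
    intro t ht
    obtain ⟨f', hf', hle⟩ := hd t ht
    refine ⟨_, ?_, (((hasDerivAt_id t).const_mul (-C)).exp).mul hf'⟩
    have := mul_le_mul_of_nonneg_left hle (Real.exp_pos (-C * t)).le
    simp only [id, mul_one]
    linarith
  have hanti : AntitoneOn (fun t => Real.exp (-C * t) * f t) (Set.Icc 0 T) := by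
    refine antitoneOn_of_deriv_nonpos (convex_Icc 0 T) (by fun_prop) ?_ ?_ <;>
      rw [interior_Icc] <;> intro t ht <;> obtain ⟨g', hg', h⟩ := hg t ht
    · exact h.differentiableAt.differentiableWithinAt
    · rwa [h.deriv]
  intro t ht
  have h := hanti ⟨le_rfl, ht.1.trans ht.2⟩ ht ht.1
  simp only [h0, mul_zero] at h
  exact le_antisymm (nonpos_of_mul_nonpos_right h (Real.exp_pos _)) (hnn t ht)

lemma eq_zero_of_setIntegral_cube_eq_zero {n : ℕ} {f : (Fin n → ℝ) → ℝ} (hf : Continuous f)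
    (hper : ZPeriodic f) (hnn : ∀ x, 0 ≤ f x) (h : ∫ x in cube n, f x = 0) (x : Fin n → ℝ) :
    f x = 0 := by
  have hae := (setIntegral_eq_zero_iff_of_nonneg_ae (.of_forall hnn)
    (hf.continuousOn.integrableOn_compact (isCompact_cube n))).1 h
  have hsub : cube n ⊆ closure (interior (cube n)) := by
    rw [cube, interior_pi_set Set.finite_univ, closure_pi_set]
    simp [closure_Ioo]
  have heq := Measure.eqOn_of_ae_eq hae hf.continuousOn continuousOn_const hsub
  rw [← hper x fun i => -⌊x i⌋]
  refine heq fun i _ => ?_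
  simp only [Pi.add_apply, Int.cast_neg, ← sub_eq_add_neg]
  exact ⟨Int.fract_nonneg _, (Int.fract_lt_one _).le⟩

lemma exists_norm_fderiv_slice_le {E F : Type*} [NormedAddCommGroup E] [NormedSpace ℝ E]
    [NormedAddCommGroup F] [NormedSpace ℝ F] {K : Set E} (hK : IsCompact K) {u : ℝ → E → F}
    {a b : ℝ} (hab : a < b)
    (hu : ContDiffOn ℝ 1 (fun z : ℝ × E => u z.1 z.2) (Set.Icc a b ×ˢ Set.univ)) :
    ∃ C, ∀ t ∈ Set.Icc a b, ∀ x ∈ K, ‖fderiv ℝ (u t) x‖ ≤ C := by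
  have hud : UniqueDiffOn ℝ (Set.Icc a b ×ˢ (Set.univ : Set E)) :=
    (uniqueDiffOn_Icc hab).prod uniqueDiffOn_univ
  have hcd := hu.continuousOn_fderivWithin hud le_rfl
  have hcont := hcd.clm_comp (continuousOn_const (c := ContinuousLinearMap.inr ℝ ℝ E))
  obtain ⟨C, hC⟩ := (isCompact_Icc.prod hK).exists_bound_of_continuousOn
    (hcont.mono (Set.prod_mono_right (Set.subset_univ K)))
  refine ⟨C, fun t ht x hx => ?_⟩
  have h1 := (hu.differentiableOn one_ne_zero (t, x) ⟨ht, trivial⟩).hasFDerivWithinAt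
  have h2 : HasFDerivWithinAt (u t) _ Set.univ x :=
    h1.comp x (hasFDerivAt_prodMk_right t x).hasFDerivWithinAt fun y _ => ⟨ht, trivial⟩
  rw [(hasFDerivWithinAt_univ.1 h2).fderiv]
  exact hC (t, x) ⟨ht, hx⟩

lemma neg_dotp_lineStretch_le {n : ℕ} {X ξ : (Fin n → ℝ) → (Fin n → ℝ)} {x : Fin n → ℝ} {C : ℝ}
    (hC : ‖fderiv ℝ X x‖ ≤ C) :
    -dotp (ξ x) (lineStretch X ξ x) ≤ C * n * dotp (ξ x) (ξ x) := by
  have ha : ∀ i j, |fderiv ℝ X x (Pi.single i 1) j| ≤ C := fun i j => by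
    refine (norm_le_pi_norm (fderiv ℝ X x (Pi.single i 1)) j).trans
      (((fderiv ℝ X x).le_opNorm _).trans ?_)
    simpa [Pi.norm_single] using hC
  have hsum : C * n * dotp (ξ x) (ξ x)
      = ∑ i, ∑ j, C * ((ξ x i * ξ x i + ξ x j * ξ x j) / 2) := by
    simp only [← Finset.mul_sum, ← Finset.sum_div, Finset.sum_add_distrib, Finset.sum_const,
      Finset.card_univ, Fintype.card_fin, nsmul_eq_mul, dotp,
      mul_left_comm _ (n : ℝ)]
    ring
  rw [hsum, dotp, ← Finset.sum_neg_distrib]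
  refine Finset.sum_le_sum fun i _ => ?_
  rw [lineStretch, Finset.mul_sum, ← Finset.sum_neg_distrib]
  refine Finset.sum_le_sum fun j _ => ?_
  have h := abs_le.1 (ha i j)
  nlinarith [mul_nonneg (sub_nonneg.2 h.2) (sq_nonneg (ξ x i - ξ x j)),
    mul_nonneg (neg_le_iff_add_nonneg.1 h.1) (sq_nonneg (ξ x i + ξ x j)),
    mul_nonneg (sub_nonneg.2 h.2) (sq_nonneg (ξ x i + ξ x j)),
    mul_nonneg (neg_le_iff_add_nonneg.1 h.1) (sq_nonneg (ξ x i - ξ x j))]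

lemma gradf_sub_add_half_sq {n : ℕ} {p q : (Fin n → ℝ) → ℝ} {u : (Fin n → ℝ) → (Fin n → ℝ)}
    {x : Fin n → ℝ} (hp : DifferentiableAt ℝ p x) (hq : DifferentiableAt ℝ q x)
    (hu : DifferentiableAt ℝ u x) :
    gradf (fun y => q y - p y + 1 / 2 * ∑ j, u y j * u y j) x
      = gradf q x - gradf p x + lineStretch u u x := by
  have du := fun j => hasFDerivAt_pi'.1 hu.hasFDerivAt j
  have h := (hq.hasFDerivAt.sub hp.hasFDerivAt).add
    ((HasFDerivAt.fun_sum (u := Finset.univ) fun j _ => (du j).mul (du j)).const_mul (1 / 2))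
  ext i
  refine (DFunLike.congr_fun h.fderiv (Pi.single i 1)).trans ?_
  simp [gradf, lineStretch, ← two_mul, ← Finset.mul_sum, mul_comm (u x _)]

lemma lineStretch_sub {n : ℕ} (X v u : (Fin n → ℝ) → (Fin n → ℝ)) (x : Fin n → ℝ) :
    lineStretch X (fun y => v y - u y) x = lineStretch X v x - lineStretch X u x := by
  ext i
  simp [lineStretch, mul_sub]

lemma lap_sub {n : ℕ} {v u : (Fin n → ℝ) → (Fin n → ℝ)} (hv : ContDiff ℝ 2 v)
    (hu : ContDiff ℝ 2 u) (x : Fin n → ℝ) :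
    lap (fun y => v y - u y) x = lap v x - lap u x := by
  have hd : ∀ {w : (Fin n → ℝ) → (Fin n → ℝ)}, ContDiff ℝ 2 w → ∀ e,
      Differentiable ℝ fun y => fderiv ℝ w y e := fun hw e =>
    ((hw.fderiv_right (m := 1) (by norm_num)).clm_apply contDiff_const).differentiable one_ne_zero
  have h1 : ∀ y, fderiv ℝ (fun y => v y - u y) y = fderiv ℝ v y - fderiv ℝ u y := fun y =>
    fderiv_fun_sub (hv.differentiable two_ne_zero y) (hu.differentiable two_ne_zero y)
  simp only [lap, h1, sub_apply, ← Finset.sum_sub_distrib]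
  refine Finset.sum_congr rfl fun j _ => ?_
  rw [fderiv_fun_sub (hd hv _ x) (hd hu _ x), sub_apply]

lemma ContDiffOn.contDiff_slice {E F : Type*} [NormedAddCommGroup E] [NormedSpace ℝ E]
    [NormedAddCommGroup F] [NormedSpace ℝ F] {k : WithTop ℕ∞} {f : ℝ → E → F} {I : Set ℝ}
    (hf : ContDiffOn ℝ k (fun z : ℝ × E => f z.1 z.2) (I ×ˢ Set.univ)) {t : ℝ} (ht : t ∈ I) :
    ContDiff ℝ k (f t) :=
  contDiffOn_univ.1 (hf.comp (f := fun x => (t, x)) (by fun_prop) fun _ _ => ⟨ht, trivial⟩)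

lemma ContDiffOn.differentiableOn_slice {E F : Type*} [NormedAddCommGroup E] [NormedSpace ℝ E]
    [NormedAddCommGroup F] [NormedSpace ℝ F] {f : ℝ → E → F} {I : Set ℝ}
    (hf : ContDiffOn ℝ 1 (fun z : ℝ × E => f z.1 z.2) (I ×ˢ Set.univ)) (x : E) :
    DifferentiableOn ℝ (fun t => f t x) I :=
  (hf.differentiableOn one_ne_zero).comp (f := fun t => (t, x)) (by fun_prop)
    fun t (ht : t ∈ I) => ⟨ht, trivial⟩

lemma derivWithin_dotp_self {n : ℕ} {w : ℝ → Fin n → ℝ} {I : Set ℝ} {t : ℝ}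
    (hw : DifferentiableWithinAt ℝ w I t) (hI : UniqueDiffWithinAt ℝ I t) :
    derivWithin (fun τ => dotp (w τ) (w τ)) I t = 2 * dotp (w t) (derivWithin w I t) := by
  have h := hasDerivWithinAt_pi.1 hw.hasDerivWithinAt
  have h2 := HasDerivWithinAt.fun_sum (u := Finset.univ) fun j _ => (h j).mul (h j)
  refine (h2.derivWithin hI).trans ?_
  rw [dotp, Finset.mul_sum]
  exact Finset.sum_congr rfl fun j _ => by ring

lemma dotp_self_nonneg {n : ℕ} (w : Fin n → ℝ) : 0 ≤ dotp w w :=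
  Finset.sum_nonneg fun i _ => mul_self_nonneg (w i)

lemma eq_zero_of_dotp_self_eq_zero {n : ℕ} {w : Fin n → ℝ} (h : dotp w w = 0) : w = 0 := by
  funext i
  exact mul_self_eq_zero.1
    ((Finset.sum_eq_zero_iff_of_nonneg fun i _ => mul_self_nonneg (w i)).1 h i (Finset.mem_univ i))

lemma dotp_sub_right {n : ℕ} (a b c : Fin n → ℝ) : dotp a (b - c) = dotp a b - dotp a c := by
  simp [dotp, mul_sub]

/-- deterministic core of Theorem 3(2): a smooth, spatially
periodic, divergence-free solution `v` of the linearized equation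
`∂_t v = −∇_u v − u'⊗v − ∇q + ηΔv` with `v(0,·) = u(0,·)`, where `u` solves
the incompressible Navier–Stokes equation `∂_t u = −∇_u u − ∇p + ηΔu`,
coincides with `u` on `[0,T]`. -/
theorem stmt14 {n : ℕ} (η T : ℝ) (hη : 0 < η) (hT : 0 < T)
    (u v : ℝ → (Fin n → ℝ) → (Fin n → ℝ)) (p q : ℝ → (Fin n → ℝ) → ℝ)
    (hu : ContDiffOn ℝ (⊤:ℕ∞) (fun z : ℝ × (Fin n → ℝ) => u z.1 z.2)
      (Set.Icc 0 T ×ˢ Set.univ))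
    (hv : ContDiffOn ℝ (⊤:ℕ∞) (fun z : ℝ × (Fin n → ℝ) => v z.1 z.2)
      (Set.Icc 0 T ×ˢ Set.univ))
    (hp : ContDiffOn ℝ (⊤:ℕ∞) (fun z : ℝ × (Fin n → ℝ) => p z.1 z.2)
      (Set.Icc 0 T ×ˢ Set.univ))
    (hq : ContDiffOn ℝ (⊤:ℕ∞) (fun z : ℝ × (Fin n → ℝ) => q z.1 z.2)
      (Set.Icc 0 T ×ˢ Set.univ))
    (hup : ∀ t ∈ Set.Icc (0:ℝ) T, ZPeriodic (u t))
    (hvp : ∀ t ∈ Set.Icc (0:ℝ) T, ZPeriodic (v t))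
    (hpp : ∀ t ∈ Set.Icc (0:ℝ) T, ZPeriodic (p t))
    (hqp : ∀ t ∈ Set.Icc (0:ℝ) T, ZPeriodic (q t))
    (hdivu : ∀ t ∈ Set.Icc (0:ℝ) T, ∀ x, diver (u t) x = 0)
    (hdivv : ∀ t ∈ Set.Icc (0:ℝ) T, ∀ x, diver (v t) x = 0)
    (hNSE : ∀ t ∈ Set.Icc (0:ℝ) T, ∀ x,
      derivWithin (fun τ => u τ x) (Set.Icc 0 T) t
        = -advDeriv (u t) (u t) x - gradf (p t) x + η • lap (u t) x)
    (hLin : ∀ t ∈ Set.Icc (0:ℝ) T, ∀ x,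
      derivWithin (fun τ => v τ x) (Set.Icc 0 T) t
        = -advDeriv (u t) (v t) x - lineStretch (u t) (v t) x - gradf (q t) x
          + η • lap (v t) x)
    (hinit : ∀ x, v 0 x = u 0 x) :
    ∀ t ∈ Set.Icc (0:ℝ) T, ∀ x, v t x = u t x := by
  set w : ℝ → (Fin n → ℝ) → (Fin n → ℝ) := fun t x => v t x - u t x with hw_def
  have hw : ContDiffOn ℝ (⊤:ℕ∞) (fun z : ℝ × (Fin n → ℝ) => w z.1 z.2)
    (Set.Icc 0 T ×ˢ Set.univ) := hv.sub hu
  have hle1 : (1 : WithTop ℕ∞) ≤ ((⊤ : ℕ∞) : WithTop ℕ∞) := by exact_mod_cast le_top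
  have hle2 : (2 : WithTop ℕ∞) ≤ ((⊤ : ℕ∞) : WithTop ℕ∞) :=
    WithTop.coe_le_coe.2 (le_top : (2 : ℕ∞) ≤ ⊤)
  have hwp : ∀ t ∈ Set.Icc (0:ℝ) T, ZPeriodic (w t) := fun t ht x m => by
    simp only [hw_def, hup t ht x m, hvp t ht x m]
  have hG : ContDiffOn ℝ 1 (fun z : ℝ × (Fin n → ℝ) => dotp (w z.1 z.2) (w z.1 z.2))
      (Set.Icc 0 T ×ˢ Set.univ) := by
    have := contDiffOn_pi.1 (hw.of_le hle1)
    unfold dotp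
    fun_prop
  obtain ⟨C, hC⟩ := exists_norm_fderiv_slice_le (isCompact_cube n) hT (hu.of_le hle1)
  have hevol : ∀ t ∈ Set.Icc (0:ℝ) T, ∀ x, derivWithin (fun τ => w τ x) (Set.Icc 0 T) t
      = (-advDeriv (u t) (w t) x
          - gradf (fun y => q t y - p t y + 1 / 2 * ∑ j, u t y j * u t y j) x
          + η • lap (w t) x) - lineStretch (u t) (w t) x := by
    intro t ht x
    have hut := hu.contDiff_slice ht
    have hvt := hv.contDiff_slice ht
    have hadv : advDeriv (u t) (w t) x = advDeriv (u t) (v t) x - advDeriv (u t) (u t) x := by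
      simp only [advDeriv, hw_def]
      rw [fderiv_fun_sub (hvt.differentiable (by simp) x) (hut.differentiable (by simp) x),
        sub_apply]
    rw [hadv, gradf_sub_add_half_sq ((hp.contDiff_slice ht).differentiable (by simp) x)
      ((hq.contDiff_slice ht).differentiable (by simp) x) (hut.differentiable (by simp) x),
      lap_sub (hvt.of_le hle2) (hut.of_le hle2), lineStretch_sub, derivWithin_fun_sub
        ((hv.of_le hle1).differentiableOn_slice x t ht)
        ((hu.of_le hle1).differentiableOn_slice x t ht), hLin t ht x, hNSE t ht x, smul_sub]
    abel
  have hdivw : ∀ t ∈ Set.Icc (0:ℝ) T, ∀ x, diver (w t) x = 0 := by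
    intro t ht x
    have h : diver (w t) x = diver (v t) x - diver (u t) x := by
      simp only [diver, hw_def]
      rw [fderiv_fun_sub ((hv.contDiff_slice ht).differentiable (by simp) x)
        ((hu.contDiff_slice ht).differentiable (by simp) x)]
      simp [Finset.sum_sub_distrib]
    rw [h, hdivv t ht, hdivu t ht, sub_zero]
  have henergy : ∀ t ∈ Set.Icc (0:ℝ) T, ∫ x in cube n, dotp (w t x) (w t x) = 0 := by
    refine eq_zero_of_deriv_le_mul (C := 2 * (C * n))
      (continuousOn_setIntegral_of_continuousOn (isCompact_cube n) hG.continuousOn) ?_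
      (by simp [hw_def, hinit, dotp]) fun t _ => integral_nonneg fun x => dotp_self_nonneg _
    intro t ht
    have ht' := Set.Ioo_subset_Icc_self ht
    obtain ⟨hint, hderiv⟩ := hasDerivAt_setIntegral_of_contDiffOn (isCompact_cube n)
      (G := fun t x => dotp (w t x) (w t x)) hG ht
    refine ⟨_, hderiv, ?_⟩
    have hut := (hu.contDiff_slice ht').of_le hle1
    have hutj := contDiff_pi.1 hut
    have hpt := (hp.contDiff_slice ht').of_le hle1
    have hqt := (hq.contDiff_slice ht').of_le hle1
    obtain ⟨hNi, hN⟩ := integral_cube_dotp_transport_diffusion_nonpos hη.le hut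
      ((hw.contDiff_slice ht').of_le hle2)
      (π := fun y => q t y - p t y + 1 / 2 * ∑ j, u t y j * u t y j) (by fun_prop)
      (hup t ht') (hwp t ht')
      (fun x m => by simp only [hup t ht' x m, hpp t ht' x m, hqp t ht' x m])
      (hdivu t ht') (hdivw t ht')
    have hGi : IntegrableOn (fun x => dotp (w t x) (w t x)) (cube n) :=
      (hG.contDiff_slice (f := fun t x => dotp (w t x) (w t x))
        ht').continuous.continuousOn.integrableOn_compact (isCompact_cube n)
    refine (setIntegral_mono_on hint ((hNi.const_mul 2).add (hGi.const_mul (2 * (C * n))))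
      (isCompact_cube n).measurableSet fun x hx => ?_).trans ?_
    · rw [derivWithin_dotp_self ((hw.of_le hle1).differentiableOn_slice x t ht')
        (uniqueDiffOn_Icc hT t ht'), hevol t ht' x, dotp_sub_right]
      have := neg_dotp_lineStretch_le (ξ := w t) (hC t ht' x hx)
      simp only [Pi.add_apply]
      linarith
    · rw [integral_add' (hNi.const_mul 2) (hGi.const_mul (2 * (C * n))), integral_const_mul,
        integral_const_mul]
      linarith
  intro t ht x
  have hGt : Continuous fun x => dotp (w t x) (w t x) :=
    (hG.contDiff_slice (f := fun t x => dotp (w t x) (w t x)) ht).continuous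
  exact sub_eq_zero.1 (eq_zero_of_dotp_self_eq_zero (eq_zero_of_setIntegral_cube_eq_zero hGt
    (fun x m => by simp only [hwp t ht x m]) (fun x => dotp_self_nonneg _) (henergy t ht) x))
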